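/- arXiv:2202.07932 — 11 statements merged into one kernel-verified Lean document; each statement's English description precedes it below -/
import Mathlib

section
/- Let n ∈ ℕ, a : Fin n → ℕ and T ∈ ℕ with T ≤ A, where A := ∑_{i} a i. Extend a to a sequence a' of n + 2 numbers by keeping a'_i = a_i for i ∈ Fin n and setting the two new items to T + 1 and A + 1 − T. Then there exists S ⊆ Fin n with ∑_{i ∈ S} a i = T if and only if there exists S' ⊆ Fin (n+2) with ∑_{i ∈ S'} a'_i = ∑_{i ∉ S'} a'_i. -/
/-- A sum over a finite subset of `Fin (n + 2)` splits off the contributions of the last two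
indices. -/
theorem sum_finset_fin_add_two {n : ℕ} (f : Fin (n + 2) → ℕ) (s : Finset (Fin (n + 2))) :
    ∑ i ∈ s, f i = ∑ i : Fin n with i.castSucc.castSucc ∈ s, f i.castSucc.castSucc
      + (if (Fin.last n).castSucc ∈ s then f (Fin.last n).castSucc else 0)
      + (if Fin.last (n + 1) ∈ s then f (Fin.last (n + 1)) else 0) := by
  rw [← Finset.univ_inter s, ← Finset.sum_ite_mem, Fin.sum_univ_castSucc, Fin.sum_univ_castSucc,
    Finset.univ_inter, Finset.sum_filter]

/-- Correctness of the classical reduction from Subset Sum to Partition: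
given items `a : Fin n → ℕ` and target `T ≤ A = ∑ a`, extend `a` by the two
items `T + 1` and `A + 1 - T`; then some subset of the original items sums to
`T` iff the extended items can be partitioned into two parts of equal sum. -/
theorem subsetSum_to_partition (n : ℕ) (a : Fin n → ℕ) (T : ℕ)
    (hT : T ≤ ∑ i, a i)
    (a' : Fin (n + 2) → ℕ)
    (ha' : ∀ i : Fin n, a' (Fin.castLE (by omega) i) = a i)
    (haT : a' ⟨n, by omega⟩ = T + 1)
    (haA : a' ⟨n + 1, by omega⟩ = (∑ i, a i) + 1 - T) :
    (∃ S : Finset (Fin n), ∑ i ∈ S, a i = T) ↔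
      (∃ S' : Finset (Fin (n + 2)), ∑ i ∈ S', a' i = ∑ i ∈ S'ᶜ, a' i) := by
  replace ha' : ∀ i : Fin n, a' i.castSucc.castSucc = a i := ha'
  replace haT : a' (Fin.last n).castSucc = T + 1 := haT
  replace haA : a' (Fin.last (n + 1)) = (∑ i, a i) + 1 - T := haA
  have hsplit (s : Finset (Fin (n + 2))) := sum_finset_fin_add_two a' s
  simp only [ha', haT, haA] at hsplit
  constructor
  · rintro ⟨S, hS⟩
    refine ⟨insert (Fin.last (n + 1)) (S.map (Fin.castSuccEmb.trans Fin.castSuccEmb)), ?_⟩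
    have hcompl := Finset.sum_add_sum_compl S a
    have hnot : Finset.univ.filter (· ∉ S) = Sᶜ := by ext; simp
    rw [hsplit, hsplit]
    simp [Fin.castSucc_ne_last, Fin.castSucc_inj, hnot, hS]
    omega
  · rintro ⟨S', hS'⟩
    rw [hsplit, hsplit] at hS'
    have hcompl := Finset.sum_filter_add_sum_filter_not Finset.univ
      (fun i : Fin n => i.castSucc.castSucc ∈ S') a
    simp only [Finset.mem_compl] at hS'
    by_cases hlast : Fin.last (n + 1) ∈ S'
    · refine ⟨Finset.univ.filter fun i => i.castSucc.castSucc ∈ S', ?_⟩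
      split_ifs at hS' <;> omega
    · refine ⟨Finset.univ.filter fun i => i.castSucc.castSucc ∉ S', ?_⟩
      split_ifs at hS' <;> omega
end

section
/- Let n ∈ ℕ and a : Fin n → ℕ with A := ∑_i a i even. Consider n jobs where job j has processing time a j, weight a j and due date A/2. Then there exists S ⊆ Fin n with 2 · ∑_{i ∈ S} a i = A if and only if there exists a single-machine schedule s for these jobs such that the total weight of late jobs satisfies ∑_{j : s j + a j > A/2} a j ≤ A/2. -/
/-- A single-machine schedule: start times with pairwise disjoint execution intervals. -/
def IsSchedule {N : ℕ} (p : Fin N → ℕ) (s : Fin N → ℕ) : Prop :=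
  ∀ i j : Fin N, i ≠ j → s i + p i ≤ s j ∨ s j + p j ≤ s i

/-- Jobs of a schedule that all complete by time `D` have total processing time at most `D`. -/
theorem IsSchedule.sum_le_of_forall_completion_le {N : ℕ} {p s : Fin N → ℕ} (hs : IsSchedule p s)
    {T : Finset (Fin N)} {D : ℕ} (hT : ∀ j ∈ T, s j + p j ≤ D) : ∑ j ∈ T, p j ≤ D := by
  have hdisj : (T : Set (Fin N)).PairwiseDisjoint fun j => Finset.Ico (s j) (s j + p j) := by
    intro i _ j _ hij
    refine Finset.disjoint_left.2 fun x hxi hxj => ?_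
    rw [Finset.mem_Ico] at hxi hxj
    have := hs i j hij
    omega
  calc ∑ j ∈ T, p j = (T.biUnion fun j => Finset.Ico (s j) (s j + p j)).card := by
        simp [Finset.card_biUnion hdisj]
    _ ≤ (Finset.range D).card := by
        refine Finset.card_le_card fun x hx => ?_
        obtain ⟨j, hj, hx⟩ := Finset.mem_biUnion.1 hx
        rw [Finset.mem_Ico] at hx
        have := hT j hj
        rw [Finset.mem_range]
        omega
    _ = D := Finset.card_range D

/-- Processing the jobs of `T` consecutively in index order, the job `j` completes no later than
the total processing time of any set of jobs containing `j` and its predecessors. -/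
theorem sum_filter_lt_add_le {N : ℕ} (p : Fin N → ℕ) {T U : Finset (Fin N)} {j : Fin N}
    (hj : j ∈ U) (hU : ∀ i ∈ T, i < j → i ∈ U) :
    ∑ i ∈ T with i < j, p i + p j ≤ ∑ i ∈ U, p i := by
  rw [add_comm, ← Finset.sum_insert (by simp)]
  refine Finset.sum_le_sum_of_subset fun i hi => ?_
  rw [Finset.mem_insert, Finset.mem_filter] at hi
  rcases hi with rfl | ⟨hi, hij⟩
  exacts [hj, hU i hi hij]

/-- Any set `S` of jobs can be processed first, completing by its total processing time. -/
theorem exists_isSchedule_forall_completion_le {N : ℕ} (p : Fin N → ℕ) (S : Finset (Fin N)) :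
    ∃ s : Fin N → ℕ, IsSchedule p s ∧ ∀ j ∈ S, s j + p j ≤ ∑ i ∈ S, p i := by
  have hle : ∀ j ∈ S, ∑ i ∈ S with i < j, p i + p j ≤ ∑ i ∈ S, p i := fun j hj =>
    sum_filter_lt_add_le p hj fun i hi _ => hi
  have hlt : ∀ (T : Finset (Fin N)) (i j : Fin N), i ∈ T → i < j →
      ∑ k ∈ T with k < i, p k + p i ≤ ∑ k ∈ T with k < j, p k := fun T i j hi hij =>
    sum_filter_lt_add_le p (Finset.mem_filter.2 ⟨hi, hij⟩) fun k hk hki =>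
      Finset.mem_filter.2 ⟨hk, hki.trans hij⟩
  refine ⟨fun j => if j ∈ S then ∑ i ∈ S with i < j, p i
    else ∑ i ∈ S, p i + ∑ i ∈ Sᶜ with i < j, p i, fun i j hij => ?_, fun j hj => ?_⟩
  · by_cases hi : i ∈ S <;> by_cases hj : j ∈ S <;> simp only [hi, hj, if_true, if_false]
    · exact (lt_or_gt_of_ne hij).imp (hlt S i j hi) (hlt S j i hj)
    · exact Or.inl ((hle i hi).trans (Nat.le_add_right _ _))
    · exact Or.inr ((hle j hj).trans (Nat.le_add_right _ _))
    · refine (lt_or_gt_of_ne hij).imp (fun h => ?_) fun h => ?_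
      · have := hlt Sᶜ i j (Finset.mem_compl.2 hi) h
        omega
      · have := hlt Sᶜ j i (Finset.mem_compl.2 hj) h
        omega
  · simpa only [hj, if_true] using hle j hj

/-- Correctness of the reduction from Partition to `1||∑wⱼUⱼ` with
`p_j = w_j = a_j`, uniform due date `A/2` and threshold `A/2`: the items can be
partitioned into two halves of equal sum iff there is a single-machine schedule
whose late jobs (those completing after `A/2`) have total weight at most `A/2`. -/
theorem partition_to_weightedLateJobs (n : ℕ) (a : Fin n → ℕ)
    (hA : Even (∑ i, a i)) :
    (∃ S : Finset (Fin n), 2 * ∑ i ∈ S, a i = ∑ i, a i) ↔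
      (∃ s : Fin n → ℕ, IsSchedule a s ∧
        ∑ j ∈ Finset.univ.filter (fun j => (∑ i, a i) / 2 < s j + a j), a j ≤
          (∑ i, a i) / 2) := by
  obtain ⟨h, hA⟩ := hA
  have hhalf : (∑ i, a i) / 2 = h := by omega
  rw [hhalf]
  constructor
  · rintro ⟨S, hS⟩
    obtain ⟨s, hs, hsS⟩ := exists_isSchedule_forall_completion_le a S
    refine ⟨s, hs, ?_⟩
    have hsub : Finset.univ.filter (fun j => h < s j + a j) ⊆ Sᶜ := by
      intro j hj
      rw [Finset.mem_filter] at hj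
      rw [Finset.mem_compl]
      intro hjS
      have := hsS j hjS
      omega
    have hlate := Finset.sum_le_sum_of_subset (f := a) hsub
    have hcompl := Finset.sum_add_sum_compl S a
    omega
  · rintro ⟨s, hs, hlate⟩
    refine ⟨Finset.univ.filter fun j => ¬ h < s j + a j, ?_⟩
    have hsplit := Finset.sum_filter_add_sum_filter_not Finset.univ (fun j => h < s j + a j) a
    have honTime := hs.sum_le_of_forall_completion_le (D := h)
      (T := Finset.univ.filter fun j => ¬ h < s j + a j)
      fun j hj => not_lt.1 (Finset.mem_filter.1 hj).2
    omega
end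

section
/- Let n ∈ ℕ, v, a : Fin n → ℕ and T, y ∈ ℕ with y ≤ ∑_j v j. Consider n jobs where job j has processing time a j, weight v j and due date T. Then there exists S ⊆ Fin n with ∑_{j ∈ S} a j ≤ T and ∑_{j ∈ S} v j ≥ y if and only if there exists a single-machine schedule s for these jobs such that the total weight of late jobs satisfies ∑_{j : s j + a j > T} v j ≤ (∑_j v j) − y. -/
/-- The jobs of `A` that precede `i ∈ A`, together with `i` itself, fit into the total size of any
set containing them. -/
theorem sum_filter_lt_add_le_s2 {ι : Type*} [LinearOrder ι] (p : ι → ℕ) {A B : Finset ι} {i : ι}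
    (hi : i ∈ B) (hAB : ∀ k ∈ A, k < i → k ∈ B) :
    ∑ k ∈ A with k < i, p k + p i ≤ ∑ k ∈ B, p k := by
  rw [add_comm, ← Finset.sum_insert (by simp)]
  refine Finset.sum_le_sum_of_subset fun k hk => ?_
  rcases Finset.mem_insert.1 hk with rfl | hk
  · exact hi
  · exact hAB k (Finset.mem_filter.1 hk).1 (Finset.mem_filter.1 hk).2

/-- The schedule that processes the jobs of `S` from time `0` and the other jobs from time `T`,
both in index order and without idle time. -/
def splitSchedule {N : ℕ} (p : Fin N → ℕ) (S : Finset (Fin N)) (T : ℕ) (j : Fin N) : ℕ :=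
  if j ∈ S then ∑ k ∈ S with k < j, p k else T + ∑ k ∈ Sᶜ with k < j, p k

theorem splitSchedule_add_le {N : ℕ} (p : Fin N → ℕ) {S : Finset (Fin N)} {T : ℕ}
    (hS : ∑ j ∈ S, p j ≤ T) {j : Fin N} (hj : j ∈ S) : splitSchedule p S T j + p j ≤ T := by
  rw [splitSchedule, if_pos hj]
  exact (sum_filter_lt_add_le_s2 p hj fun _ hk _ => hk).trans hS

theorem isSchedule_splitSchedule {N : ℕ} (p : Fin N → ℕ) {S : Finset (Fin N)} {T : ℕ}
    (hS : ∑ j ∈ S, p j ≤ T) : IsSchedule p (splitSchedule p S T) := by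
  have sequential (A : Finset (Fin N)) {i j : Fin N} (hi : i ∈ A) (hij : i < j) :
      ∑ k ∈ A with k < i, p k + p i ≤ ∑ k ∈ A with k < j, p k :=
    sum_filter_lt_add_le_s2 p (Finset.mem_filter.2 ⟨hi, hij⟩) fun _ hk hki =>
      Finset.mem_filter.2 ⟨hk, hki.trans hij⟩
  have separated {i j : Fin N} (hi : i ∈ S) (hj : j ∉ S) :
      splitSchedule p S T i + p i ≤ splitSchedule p S T j := by
    refine (splitSchedule_add_le p hS hi).trans ?_
    rw [splitSchedule, if_neg hj]
    exact Nat.le_add_right _ _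
  have ordered {i j : Fin N} (hij : i < j) (h : i ∈ S ↔ j ∈ S) :
      splitSchedule p S T i + p i ≤ splitSchedule p S T j := by
    by_cases hi : i ∈ S
    · simpa [splitSchedule, hi, h.1 hi] using sequential S hi hij
    · have hj : j ∉ S := fun hj => hi (h.2 hj)
      have := sequential Sᶜ (Finset.mem_compl.2 hi) hij
      simp only [splitSchedule, hi, hj, if_false]
      omega
  intro i j hij
  by_cases hi : i ∈ S <;> by_cases hj : j ∈ S
  · exact hij.lt_or_gt.imp (ordered · (by tauto)) (ordered · (by tauto))
  · exact Or.inl (separated hi hj)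
  · exact Or.inr (separated hj hi)
  · exact hij.lt_or_gt.imp (ordered · (by tauto)) (ordered · (by tauto))

/-- Jobs that all complete by time `T` have total processing time at most `T`. -/
theorem IsSchedule.sum_le {N : ℕ} {p s : Fin N → ℕ} (hs : IsSchedule p s) {A : Finset (Fin N)}
    {T : ℕ} (hA : ∀ j ∈ A, s j + p j ≤ T) : ∑ j ∈ A, p j ≤ T := by
  have hdisj : (A : Set (Fin N)).PairwiseDisjoint fun j => Finset.Ico (s j) (s j + p j) := by
    intro i _ j _ hij
    refine Finset.disjoint_left.2 fun t hi hj => ?_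
    rw [Finset.mem_Ico] at hi hj
    have := hs i j hij
    omega
  calc ∑ j ∈ A, p j = (A.biUnion fun j => Finset.Ico (s j) (s j + p j)).card := by
        simp [Finset.card_biUnion hdisj]
    _ ≤ (Finset.range T).card := by
        refine Finset.card_le_card (Finset.biUnion_subset.2 fun j hj t ht => ?_)
        have := hA j hj
        rw [Finset.mem_Ico] at ht
        exact Finset.mem_range.2 (by omega)
    _ = T := Finset.card_range T

/-- Correctness of the reduction from Knapsack to `1||∑wⱼUⱼ` with `p_j = a_j`,
`w_j = v_j`, uniform due date `T` and threshold `∑v − y`: the knapsack instance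
has a solution iff there is a single-machine schedule whose late jobs (those
completing after `T`) have total value at most `∑v − y`. -/
theorem knapsack_to_weightedLateJobs (n : ℕ) (v a : Fin n → ℕ) (T y : ℕ)
    (hy : y ≤ ∑ j, v j) :
    (∃ S : Finset (Fin n), ∑ j ∈ S, a j ≤ T ∧ y ≤ ∑ j ∈ S, v j) ↔
      (∃ s : Fin n → ℕ, IsSchedule a s ∧
        ∑ j ∈ Finset.univ.filter (fun j => T < s j + a j), v j ≤
          (∑ j, v j) - y) := by
  constructor
  · rintro ⟨S, hS, hyS⟩
    refine ⟨splitSchedule a S T, isSchedule_splitSchedule a hS, ?_⟩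
    have hlate : Finset.univ.filter (fun j => T < splitSchedule a S T j + a j) ⊆ Sᶜ :=
      fun j hj => Finset.mem_compl.2 fun hjS =>
        (Finset.mem_filter.1 hj).2.not_ge (splitSchedule_add_le a hS hjS)
    have hle := Finset.sum_le_sum_of_subset (f := v) hlate
    have hsum := Finset.sum_add_sum_compl S v
    omega
  · rintro ⟨s, hs, hlate⟩
    refine ⟨Finset.univ.filter fun j => ¬ T < s j + a j, hs.sum_le fun j hj => ?_, ?_⟩
    · exact not_lt.1 (Finset.mem_filter.1 hj).2
    · have hsum := Finset.sum_filter_add_sum_filter_not Finset.univ (fun j => T < s j + a j) v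
      omega
end

section
/- Let n ≥ 1 and a : Fin n → ℕ with a i ≥ 1 for all i. Define b₁,…,b_{2n} ∈ ℕ by b_{2n} = 1, b_{2i−1} = b_{2i} + a_i for each i ∈ [n], and b_{2i} = b_{2i+1} + 1 for each i ∈ [n−1]. Then (i) b_i > b_{i+1} for every i ∈ [2n−1], and (ii) there exists S ⊆ [n] with ∑_{i ∈ S} a_i = ∑_{i ∉ S} a_i if and only if there exists T ⊆ [2n] with |T ∩ {2i−1, 2i}| = 1 for every i ∈ [n] and ∑_{j ∈ T} b_j = ∑_{j ∉ T} b_j. -/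
open Finset in
theorem sum_Icc_two_mul_eq_sum_pairs {M : Type*} [AddCommMonoid M] (f : ℕ → M) (n : ℕ) :
    ∑ j ∈ Icc 1 (2 * n), f j = ∑ i ∈ Icc 1 n, (f (2 * i - 1) + f (2 * i)) := by
  induction n with
  | zero => simp
  | succ n ih =>
    rw [show 2 * (n + 1) = 2 * n + 1 + 1 by ring, sum_Icc_succ_top (by omega),
      sum_Icc_succ_top (by omega), ih, sum_Icc_succ_top (by omega), add_assoc]
    rfl

open Finset in
theorem card_inter_pair_eq_one_iff {α : Type*} [DecidableEq α] {T : Finset α} {x y : α}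
    (hxy : x ≠ y) : (T ∩ {x, y}).card = 1 ↔ (y ∈ T ↔ x ∉ T) := by
  by_cases hx : x ∈ T <;> by_cases hy : y ∈ T <;>
    simp [inter_insert_of_mem, inter_insert_of_notMem, hx, hy, hxy]

open Finset in
/-- If `T` selects `2 * i - 1` for `i ∈ S` and `2 * i` for the other `i`, then its sum is the sum of
the smaller elements of all pairs plus the pair differences over `S`. -/
theorem sum_transversal_eq {n : ℕ} {a b : ℕ → ℕ}
    (hb : ∀ i ∈ Icc 1 n, b (2 * i - 1) = b (2 * i) + a i) {S T : Finset ℕ}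
    (hS : S ⊆ Icc 1 n) (hT : T ⊆ Icc 1 (2 * n))
    (hST : ∀ i ∈ Icc 1 n, (2 * i - 1 ∈ T ↔ i ∈ S) ∧ (2 * i ∈ T ↔ i ∉ S)) :
    ∑ j ∈ T, b j = ∑ i ∈ Icc 1 n, b (2 * i) + ∑ i ∈ S, a i := by
  rw [← inter_eq_right.mpr hT, ← inter_eq_right.mpr hS, ← sum_ite_mem, ← sum_ite_mem,
    sum_Icc_two_mul_eq_sum_pairs, ← sum_add_distrib]
  refine sum_congr rfl fun i hi => ?_
  by_cases h : i ∈ S <;> simp [hST i hi, h, hb i hi]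

open Finset in
theorem sum_transversal_eq_sum_sdiff_iff {n : ℕ} {a b : ℕ → ℕ}
    (hb : ∀ i ∈ Icc 1 n, b (2 * i - 1) = b (2 * i) + a i) {S T : Finset ℕ}
    (hS : S ⊆ Icc 1 n) (hT : T ⊆ Icc 1 (2 * n))
    (hST : ∀ i ∈ Icc 1 n, (2 * i - 1 ∈ T ↔ i ∈ S) ∧ (2 * i ∈ T ↔ i ∉ S)) :
    ∑ j ∈ T, b j = ∑ j ∈ Icc 1 (2 * n) \ T, b j ↔
      ∑ i ∈ S, a i = ∑ i ∈ Icc 1 n \ S, a i := by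
  have hcompl : ∀ i ∈ Icc 1 n, (2 * i - 1 ∈ Icc 1 (2 * n) \ T ↔ i ∈ Icc 1 n \ S) ∧
      (2 * i ∈ Icc 1 (2 * n) \ T ↔ i ∉ Icc 1 n \ S) := by
    intro i hi
    obtain ⟨h₁, h₂⟩ := hST i hi
    have h₃ : 2 * i - 1 ∈ Icc 1 (2 * n) := by simp only [mem_Icc] at hi ⊢; omega
    have h₄ : 2 * i ∈ Icc 1 (2 * n) := by simp only [mem_Icc] at hi ⊢; omega
    simp only [mem_sdiff, hi, h₁, h₂, h₃, h₄]
    tauto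
  rw [sum_transversal_eq hb hS hT hST,
    sum_transversal_eq hb sdiff_subset sdiff_subset hcompl, add_right_inj]

/-- Correctness of the Garey–Tarjan–Wilfong reduction from Partition to
Even-Odd Partition. The items `a 1, …, a n` (all positive) are turned into
`b 1 > b 2 > … > b (2n)` via `b (2n) = 1`, `b (2i-1) = b (2i) + a i` and
`b (2i) = b (2i+1) + 1`. Then (i) the `b`'s are strictly decreasing and
(ii) the `a`'s admit a partition into two parts of equal sum iff there is a
set `T ⊆ [2n]` picking exactly one element of each pair `{2i-1, 2i}` with
`∑_{j ∈ T} b j = ∑_{j ∉ T} b j`. -/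
theorem partition_to_evenOddPartition (n : ℕ) (hn : 1 ≤ n)
    (a : ℕ → ℕ) (ha : ∀ i ∈ Finset.Icc 1 n, 1 ≤ a i)
    (b : ℕ → ℕ)
    (hb_last : b (2 * n) = 1)
    (hb_odd : ∀ i ∈ Finset.Icc 1 n, b (2 * i - 1) = b (2 * i) + a i)
    (hb_even : ∀ i ∈ Finset.Icc 1 (n - 1), b (2 * i) = b (2 * i + 1) + 1) :
    (∀ i ∈ Finset.Icc 1 (2 * n - 1), b (i + 1) < b i) ∧
    ((∃ S : Finset ℕ, S ⊆ Finset.Icc 1 n ∧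
        ∑ i ∈ S, a i = ∑ i ∈ Finset.Icc 1 n \ S, a i) ↔
      (∃ T : Finset ℕ, T ⊆ Finset.Icc 1 (2 * n) ∧
        (∀ i ∈ Finset.Icc 1 n, (T ∩ {2 * i - 1, 2 * i}).card = 1) ∧
        ∑ j ∈ T, b j = ∑ j ∈ Finset.Icc 1 (2 * n) \ T, b j)) := by
  refine ⟨fun i hi => ?_, ?_, ?_⟩
  · rw [Finset.mem_Icc] at hi
    obtain ⟨k, rfl | rfl⟩ := Nat.even_or_odd' i
    · rw [hb_even k (Finset.mem_Icc.mpr (by omega))]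
      exact Nat.lt_succ_self _
    · have hk : k + 1 ∈ Finset.Icc 1 n := Finset.mem_Icc.mpr (by omega)
      have h₁ := hb_odd (k + 1) hk
      have h₂ := ha (k + 1) hk
      rw [show 2 * (k + 1) - 1 = 2 * k + 1 by omega] at h₁
      rw [show 2 * k + 1 + 1 = 2 * (k + 1) by ring]
      omega
  · rintro ⟨S, hS, hsum⟩
    let T := (Finset.Icc 1 (2 * n)).filter fun j => (j + 1) / 2 ∈ S ↔ Odd j
    have hST : ∀ i ∈ Finset.Icc 1 n, (2 * i - 1 ∈ T ↔ i ∈ S) ∧ (2 * i ∈ T ↔ i ∉ S) := by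
      intro i hi
      rw [Finset.mem_Icc] at hi
      have h₁ : Odd (2 * i - 1) := ⟨i - 1, by omega⟩
      have h₂ : ¬ Odd (2 * i) := by simp
      simp only [T, Finset.mem_filter, Finset.mem_Icc, h₁, h₂,
        show (2 * i - 1 + 1) / 2 = i by omega, show (2 * i + 1) / 2 = i by omega, iff_true,
        iff_false]
      constructor
      · exact and_iff_right (by omega)
      · exact and_iff_right (by omega)
    refine ⟨T, Finset.filter_subset _ _, fun i hi => ?_,
      (sum_transversal_eq_sum_sdiff_iff hb_odd hS (Finset.filter_subset _ _) hST).mpr hsum⟩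
    have hi' := Finset.mem_Icc.mp hi
    rw [card_inter_pair_eq_one_iff (by omega), (hST i hi).1, (hST i hi).2]
  · rintro ⟨T, hT, hcard, hsum⟩
    refine ⟨(Finset.Icc 1 n).filter fun i => 2 * i - 1 ∈ T, Finset.filter_subset _ _,
      (sum_transversal_eq_sum_sdiff_iff hb_odd (Finset.filter_subset _ _) hT
        fun i hi => ?_).mp hsum⟩
    have hi' := Finset.mem_Icc.mp hi
    have h := (card_inter_pair_eq_one_iff (by omega)).mp (hcard i hi)
    simp [hi, h]
end

section
/- Let n ≥ 1 and b₁,…,b_{2n} ∈ ℕ with b_i > b_{i+1} for each i ∈ [2n−1], b_{2n} ≥ 1, and ∑_{i ∈ [n]} (b_{2i−1} − b_{2i}) = 2Δ for some Δ ∈ ℕ. Define c_{2i−1} = b_{2i−1} + (9n² + 3n − (i−1))Δ + 5n(b₁ − b_{2n}) and c_{2i} = b_{2i} + (9n² + 3n − (i−1))Δ + 5n(b₁ − b_{2n}) for each i ∈ [n]. Then: (i) c_i > c_{i+1} for each i ∈ [2n−1]; (ii) c_{2i} > c_{2i+1} + Δ for each i ∈ [n−1]; (iii) ∑_{i ∈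 [n]} (c_{2i−1} − c_{2i}) = 2Δ; (iv) c₁ − c_{2n} = b₁ − b_{2n} + (n−1)Δ; and (v) c_j > n(4n+1)Δ + 5n(c₁ − c_{2n}) for every j ∈ [2n]. -/
/-- The Du–Leung construction turns any Even-Odd Partition instance
`b 1 > … > b (2n)` (with `b (2n) ≥ 1` and total pair difference `2Δ`) into a
valid Restricted Even-Odd Partition instance `c` with `δ = Δ` by setting
`c (2i-1) = b (2i-1) + (9n² + 3n - (i-1))Δ + 5n(b 1 - b (2n))` and similarly
for `c (2i)`. -/
theorem evenOdd_to_restrictedEvenOdd (n : ℕ) (hn : 1 ≤ n)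
    (b : ℕ → ℕ) (Δ : ℕ)
    (hb_dec : ∀ i ∈ Finset.Icc 1 (2 * n - 1), b (i + 1) < b i)
    (hb_last : 1 ≤ b (2 * n))
    (hΔ : ∑ i ∈ Finset.Icc 1 n, (b (2 * i - 1) - b (2 * i)) = 2 * Δ)
    (c : ℕ → ℕ)
    (hc_odd : ∀ i ∈ Finset.Icc 1 n,
      c (2 * i - 1) =
        b (2 * i - 1) + (9 * n ^ 2 + 3 * n - (i - 1)) * Δ + 5 * n * (b 1 - b (2 * n)))
    (hc_even : ∀ i ∈ Finset.Icc 1 n,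
      c (2 * i) =
        b (2 * i) + (9 * n ^ 2 + 3 * n - (i - 1)) * Δ + 5 * n * (b 1 - b (2 * n))) :
    (∀ i ∈ Finset.Icc 1 (2 * n - 1), c (i + 1) < c i) ∧
    (∀ i ∈ Finset.Icc 1 (n - 1), c (2 * i + 1) + Δ < c (2 * i)) ∧
    (∑ i ∈ Finset.Icc 1 n, (c (2 * i - 1) - c (2 * i)) = 2 * Δ) ∧
    (c 1 - c (2 * n) = b 1 - b (2 * n) + (n - 1) * Δ) ∧
    (∀ j ∈ Finset.Icc 1 (2 * n),
      n * (4 * n + 1) * Δ + 5 * n * (c 1 - c (2 * n)) < c j) := by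
  have coeff : ∀ i ∈ Finset.Icc 1 n, (9 * n ^ 2 + 3 * n - (i - 1)) * Δ =
      (9 * n ^ 2 + 2 * n + 1) * Δ + (n - i) * Δ := by
    intro i hi
    rw [Finset.mem_Icc] at hi
    rw [← add_mul]
    congr 1
    omega
  have odd_eq : ∀ i, 1 ≤ i → i ≤ n → c (2 * i - 1) =
      b (2 * i - 1) + ((9 * n ^ 2 + 2 * n + 1) * Δ + (n - i) * Δ) +
        5 * n * (b 1 - b (2 * n)) := fun i h1 h2 => by
    have hi := Finset.mem_Icc.2 ⟨h1, h2⟩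
    rw [hc_odd i hi, coeff i hi]
  have even_eq : ∀ i, 1 ≤ i → i ≤ n → c (2 * i) =
      b (2 * i) + ((9 * n ^ 2 + 2 * n + 1) * Δ + (n - i) * Δ) +
        5 * n * (b 1 - b (2 * n)) := fun i h1 h2 => by
    have hi := Finset.mem_Icc.2 ⟨h1, h2⟩
    rw [hc_even i hi, coeff i hi]
  have b_last_le : b (2 * n) ≤ b 1 := by
    have le_first : ∀ k, k + 1 ≤ 2 * n → b (k + 1) ≤ b 1 := by
      intro k
      induction k with
      | zero => simp
      | succ k ih =>
        intro hk
        have := hb_dec (k + 1) (Finset.mem_Icc.2 (by omega))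
        have := ih (by omega)
        omega
    have := le_first (2 * n - 1) (by omega)
    rwa [Nat.sub_add_cancel (by omega)] at this
  have b_pos : ∀ j, 1 ≤ j → j ≤ 2 * n → 1 ≤ b j := by
    intro j h1 h2
    rcases h2.eq_or_lt with rfl | h2
    · exact hb_last
    · have := hb_dec j (Finset.mem_Icc.2 (by omega))
      omega
  have pair_gap : ∀ i, 1 ≤ i → i ≤ n → c (2 * i) < c (2 * i - 1) := by
    intro i h1 h2
    have := hb_dec (2 * i - 1) (Finset.mem_Icc.2 (by omega))
    rw [Nat.sub_add_cancel (by omega)] at this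
    rw [odd_eq i h1 h2, even_eq i h1 h2]
    omega
  have next_gap : ∀ i, 1 ≤ i → i + 1 ≤ n → c (2 * i + 1) + Δ < c (2 * i) := by
    intro i h1 h2
    have hb := hb_dec (2 * i) (Finset.mem_Icc.2 (by omega))
    have ho := odd_eq (i + 1) (by omega) h2
    rw [show 2 * (i + 1) - 1 = 2 * i + 1 by omega] at ho
    have hmul : (n - i) * Δ = (n - (i + 1)) * Δ + Δ := by
      rw [← Nat.succ_mul]
      congr 1
      omega
    rw [ho, even_eq i h1 (by omega), hmul]
    omega
  have total : c 1 - c (2 * n) = b 1 - b (2 * n) + (n - 1) * Δ := by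
    have ho := odd_eq 1 le_rfl hn
    have he := even_eq n hn le_rfl
    rw [Nat.sub_self, zero_mul] at he
    norm_num at ho
    omega
  refine ⟨?_, ?_, ?_, total, ?_⟩
  · intro j hj
    rw [Finset.mem_Icc] at hj
    obtain ⟨i, rfl | rfl⟩ := Nat.even_or_odd' j
    · have := next_gap i (by omega) (by omega)
      omega
    · exact pair_gap (i + 1) (by omega) (by omega)
  · intro i hi
    rw [Finset.mem_Icc] at hi
    exact next_gap i hi.1 (by omega)
  · rw [← hΔ]
    refine Finset.sum_congr rfl fun i hi => ?_
    rw [Finset.mem_Icc] at hi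
    rw [odd_eq i hi.1 hi.2, even_eq i hi.1 hi.2]
    omega
  · intro j hj
    rw [Finset.mem_Icc] at hj
    have lower : (9 * n ^ 2 + 2 * n + 1) * Δ + 5 * n * (b 1 - b (2 * n)) < c j := by
      have hb := b_pos j hj.1 hj.2
      obtain ⟨i, rfl | rfl⟩ := Nat.even_or_odd' j
      · rw [even_eq i (by omega) (by omega)]
        omega
      · have ho := odd_eq (i + 1) (by omega) (by omega)
        rw [show 2 * (i + 1) - 1 = 2 * i + 1 by omega] at ho
        omega
    refine lt_of_le_of_lt ?_ lower
    rw [total, mul_add (5 * n), ← add_assoc, add_right_comm, ← mul_assoc, ← add_mul]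
    refine Nat.add_le_add_right (Nat.mul_le_mul_right Δ ?_) _
    obtain ⟨m, rfl⟩ := Nat.exists_eq_add_of_le' hn
    rw [Nat.add_sub_cancel]
    nlinarith
end

section
/- Let n ∈ ℕ and a : Fin n → ℕ with A := ∑_j a j even. Then there exists S ⊆ Fin n with 2 · ∑_{i ∈ S} a i = A if and only if there exists S ⊆ Fin n with 4 · (∑_{(i,j) : i ≤ j, i ∈ S, j ∈ S} a i · a j + ∑_{(i,j) : i ≤ j, i ∉ S, j ∉ S} a i · a j) + A² ≤ 4 · ∑_{(i,j) : i ≤ j} a i · a j, where all pair sums are over ordered pairs (i, j) ∈ Fin n × Fin n with i ≤ j. -/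
open Finset in
/-- Splitting the jobs between two machines according to `S` lowers the sum over ordered pairs
by exactly the product of the two machine loads. -/
theorem sum_le_pairs_split {ι R : Type*} [Fintype ι] [LinearOrder ι] [CommSemiring R]
    (a : ι → R) (S : Finset ι) :
    ∑ q ∈ univ.filter (fun q : ι × ι => q.1 ≤ q.2 ∧ q.1 ∈ S ∧ q.2 ∈ S), a q.1 * a q.2 +
      ∑ q ∈ univ.filter (fun q : ι × ι => q.1 ≤ q.2 ∧ q.1 ∉ S ∧ q.2 ∉ S), a q.1 * a q.2 +
      (∑ i ∈ S, a i) * ∑ i ∈ Sᶜ, a i =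
    ∑ q ∈ univ.filter (fun q : ι × ι => q.1 ≤ q.2), a q.1 * a q.2 := by
  have cross : (∑ i ∈ S, a i) * ∑ i ∈ Sᶜ, a i =
      ∑ q : ι × ι, (if q.1 ≤ q.2 ∧ q.1 ∈ S ∧ q.2 ∉ S then a q.1 * a q.2 else 0) +
      ∑ q : ι × ι, (if q.1 ≤ q.2 ∧ q.1 ∉ S ∧ q.2 ∈ S then a q.1 * a q.2 else 0) := by
    rw [← Equiv.sum_comp (Equiv.prodComm ι ι)
      (fun q => if q.1 ≤ q.2 ∧ q.1 ∉ S ∧ q.2 ∈ S then a q.1 * a q.2 else 0),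
      ← sum_add_distrib, sum_mul_sum, ← sum_product', ← univ_inter (S ×ˢ Sᶜ), ← sum_ite_mem]
    refine sum_congr rfl fun ⟨i, j⟩ _ => ?_
    simp only [mem_product, mem_compl, Equiv.prodComm_apply, Prod.swap_prod_mk]
    by_cases hi : i ∈ S <;> by_cases hj : j ∈ S <;> simp only [hi, hj] <;> try simp
    rcases lt_trichotomy i j with h | rfl | h
    · simp [h.le, h.not_ge]
    · exact absurd hi hj
    · simp [h.le, h.not_ge, mul_comm]
  rw [cross, sum_filter, sum_filter, sum_filter, ← sum_add_distrib, ← sum_add_distrib,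
    ← sum_add_distrib]
  refine sum_congr rfl fun q _ => ?_
  by_cases hi : q.1 ∈ S <;> by_cases hj : q.2 ∈ S <;> simp [hi, hj]


/-- Correctness of the reduction from Partition to `P2||∑wⱼCⱼ` with
`p_j = w_j = a j` and threshold `y = ∑_{i ≤ j} a i · a j − A²/4`: a partition
into two halves of equal sum exists iff there is a split `S` of the jobs whose
two-machine total weighted completion time (expressed via restricted pair sums,
cleared of denominators) meets the threshold. -/
theorem partition_to_P2sumWjCj (n : ℕ) (a : Fin n → ℕ)
    (hA : Even (∑ j, a j)) :
    (∃ S : Finset (Fin n), 2 * ∑ i ∈ S, a i = ∑ i, a i) ↔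
      (∃ S : Finset (Fin n),
        4 * (∑ q ∈ Finset.univ.filter
              (fun q : Fin n × Fin n => q.1 ≤ q.2 ∧ q.1 ∈ S ∧ q.2 ∈ S),
              a q.1 * a q.2 +
            ∑ q ∈ Finset.univ.filter
              (fun q : Fin n × Fin n => q.1 ≤ q.2 ∧ q.1 ∉ S ∧ q.2 ∉ S),
              a q.1 * a q.2) +
          (∑ j, a j) ^ 2 ≤
        4 * ∑ q ∈ Finset.univ.filter (fun q : Fin n × Fin n => q.1 ≤ q.2),
              a q.1 * a q.2) := by
  refine exists_congr fun S => ?_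
  rw [← sum_le_pairs_split a S, ← Finset.sum_add_sum_compl S a]
  generalize ∑ i ∈ S, a i = x
  generalize ∑ i ∈ Sᶜ, a i = y
  constructor
  · intro h
    obtain rfl : x = y := by omega
    nlinarith
  · intro h
    have hxy : ((x : ℤ) - y) ^ 2 ≤ 0 := by
      zify at h
      nlinarith
    have := pow_eq_zero_iff two_ne_zero |>.mp (le_antisymm hxy (sq_nonneg _))
    omega
end

section
/- Let n ∈ ℕ and p : Fin n → ℕ × ℕ, where (p j).1 is the processing time of job j on one machine and (p j).2 its processing time on two machines. An assignment is a map g : Fin n → Fin 3; define load₁(g) := ∑_{j : g j = 0} (p j).1 + ∑_{j : g j = 2} (p j).2 and load₂(g) := ∑_{j : g j = 1} (p j).1 + ∑_{j : g j = 2} (p j).2. Define F : ℕ → ℕ → WithTop ℕ by F 0 0 = 0, F 0 t = ⊤ for t > 0, and for 1 ≤ j ≤ n, F j t = min of: F (j−1) (t − (p (j−1)).1) if (p (j−1)).1 ≤ t (else ⊤); F (j−1) t + (p (j−1)).1; and F (j−1) (t − (p (j−1)).2) + (p (j−1)).2 if (p (j−1)).2 ≤ t (else ⊤), where p (j−1)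 denotes the j-th job. Then for every t ∈ ℕ, F n t equals the infimum in WithTop ℕ of load₂(g) over all assignments g : Fin n → Fin 3 with load₁(g) = t. -/
/-- Load of machine 1 under an assignment `g` of jobs to: machine 1 (`g j = 0`),
machine 2 (`g j = 1`), or both machines (`g j = 2`); `(p j).1` is the processing
time of job `j` on one machine and `(p j).2` its processing time on two machines. -/
def load1 {n : ℕ} (p : Fin n → ℕ × ℕ) (g : Fin n → Fin 3) : ℕ :=
  ∑ j ∈ Finset.univ.filter (fun j => g j = 0), (p j).1 +
    ∑ j ∈ Finset.univ.filter (fun j => g j = 2), (p j).2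

/-- Load of machine 2 under an assignment `g`. -/
def load2 {n : ℕ} (p : Fin n → ℕ × ℕ) (g : Fin n → Fin 3) : ℕ :=
  ∑ j ∈ Finset.univ.filter (fun j => g j = 1), (p j).1 +
    ∑ j ∈ Finset.univ.filter (fun j => g j = 2), (p j).2

theorem load1_eq_sum {n : ℕ} (p : Fin n → ℕ × ℕ) (g : Fin n → Fin 3) :
    load1 p g =
      ∑ j, ((if g j = 0 then (p j).1 else 0) + if g j = 2 then (p j).2 else 0) := by
  simp only [load1, Finset.sum_filter, Finset.sum_add_distrib]

theorem load2_eq_sum {n : ℕ} (p : Fin n → ℕ × ℕ) (g : Fin n → Fin 3) :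
    load2 p g =
      ∑ j, ((if g j = 1 then (p j).1 else 0) + if g j = 2 then (p j).2 else 0) := by
  simp only [load2, Finset.sum_filter, Finset.sum_add_distrib]

theorem load1_snoc {n : ℕ} (p : Fin (n + 1) → ℕ × ℕ) (g : Fin n → Fin 3) (c : Fin 3) :
    load1 p (Fin.snoc g c : Fin (n + 1) → Fin 3) =
      load1 (fun j => p j.castSucc) g +
        ((if c = 0 then (p (Fin.last n)).1 else 0) +
          if c = 2 then (p (Fin.last n)).2 else 0) := by
  simp only [load1_eq_sum, Fin.sum_univ_castSucc, Fin.snoc_castSucc, Fin.snoc_last]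

theorem load2_snoc {n : ℕ} (p : Fin (n + 1) → ℕ × ℕ) (g : Fin n → Fin 3) (c : Fin 3) :
    load2 p (Fin.snoc g c : Fin (n + 1) → Fin 3) =
      load2 (fun j => p j.castSucc) g +
        ((if c = 1 then (p (Fin.last n)).1 else 0) +
          if c = 2 then (p (Fin.last n)).2 else 0) := by
  simp only [load2_eq_sum, Fin.sum_univ_castSucc, Fin.snoc_castSucc, Fin.snoc_last]

/-- A function satisfying the recurrence is a lower bound for the machine-2 loads. -/
theorem dp_le_load2 (n : ℕ) (p : Fin n → ℕ × ℕ) (F : ℕ → ℕ → ℕ∞)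
    (hF00 : F 0 0 = 0)
    (hFrec : ∀ (j : Fin n) (t : ℕ),
      F (j.val + 1) t =
        min (min (if (p j).1 ≤ t then F j.val (t - (p j).1) else ⊤)
                 (F j.val t + ((p j).1 : ℕ∞)))
            (if (p j).2 ≤ t then F j.val (t - (p j).2) + ((p j).2 : ℕ∞) else ⊤))
    (g : Fin n → Fin 3) : F n (load1 p g) ≤ (load2 p g : ℕ∞) := by
  induction n with
  | zero => simp [load1, hF00]
  | succ n ih =>
    induction g using Fin.snocCases with
    | snoc g c =>
    have h := ih (fun j => p j.castSucc) (fun j => hFrec j.castSucc) g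
    have hrec := hFrec (Fin.last n)
    simp only [Fin.val_last] at hrec
    rw [load1_snoc, load2_snoc, hrec]
    fin_cases c
    · refine (min_le_left _ _).trans ((min_le_left _ _).trans ?_)
      simpa using h
    · refine (min_le_left _ _).trans ((min_le_right _ _).trans ?_)
      simpa using h
    · refine (min_le_right _ _).trans ?_
      simpa using h

/-- Every finite value of a function satisfying the recurrence is attained as a machine-2 load. -/
theorem dp_eq_top_or_exists_load2 (n : ℕ) (p : Fin n → ℕ × ℕ) (F : ℕ → ℕ → ℕ∞)
    (hF00 : F 0 0 = 0)
    (hF0 : ∀ t : ℕ, 0 < t → F 0 t = ⊤)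
    (hFrec : ∀ (j : Fin n) (t : ℕ),
      F (j.val + 1) t =
        min (min (if (p j).1 ≤ t then F j.val (t - (p j).1) else ⊤)
                 (F j.val t + ((p j).1 : ℕ∞)))
            (if (p j).2 ≤ t then F j.val (t - (p j).2) + ((p j).2 : ℕ∞) else ⊤))
    (t : ℕ) :
    F n t = ⊤ ∨ ∃ g : Fin n → Fin 3, load1 p g = t ∧ F n t = (load2 p g : ℕ∞) := by
  induction n generalizing t with
  | zero =>
    rcases Nat.eq_zero_or_pos t with rfl | ht
    · exact Or.inr ⟨Fin.elim0, by simp [load1], by simp [load2, hF00]⟩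
    · exact Or.inl (hF0 t ht)
  | succ n ih =>
    have ih := ih (fun j => p j.castSucc) (fun j => hFrec j.castSucc)
    have hrec := hFrec (Fin.last n) t
    simp only [Fin.val_last] at hrec
    rcases min_choice (min (if (p (Fin.last n)).1 ≤ t then F n (t - (p (Fin.last n)).1) else ⊤)
        (F n t + ((p (Fin.last n)).1 : ℕ∞)))
        (if (p (Fin.last n)).2 ≤ t then
          F n (t - (p (Fin.last n)).2) + ((p (Fin.last n)).2 : ℕ∞) else ⊤) with h | h <;>
      rw [h] at hrec
    · rcases min_choice (if (p (Fin.last n)).1 ≤ t then F n (t - (p (Fin.last n)).1) else ⊤)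
          (F n t + ((p (Fin.last n)).1 : ℕ∞)) with h' | h' <;> rw [h'] at hrec
      · split_ifs at hrec with hle
        · rcases ih (t - (p (Fin.last n)).1) with htop | ⟨g, h1, h2⟩
          · exact Or.inl (hrec.trans htop)
          · refine Or.inr ⟨Fin.snoc g 0, ?_, ?_⟩
            · simp [load1_snoc, h1, hle]
            · simp [load2_snoc, hrec, h2]
        · exact Or.inl hrec
      · rcases ih t with htop | ⟨g, h1, h2⟩
        · exact Or.inl (by simp [hrec, htop])
        · refine Or.inr ⟨Fin.snoc g 1, ?_, ?_⟩
          · simp [load1_snoc, h1]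
          · simp [load2_snoc, hrec, h2]
    · split_ifs at hrec with hle
      · rcases ih (t - (p (Fin.last n)).2) with htop | ⟨g, h1, h2⟩
        · exact Or.inl (by simp [hrec, htop])
        · refine Or.inr ⟨Fin.snoc g 2, ?_, ?_⟩
          · simp [load1_snoc, h1, hle]
          · simp [load2_snoc, hrec, h2]
      · exact Or.inl hrec

/-- Correctness of the dynamic programming recurrence for `P2|any|C_max`:
if `F` satisfies `F 0 0 = 0`, `F 0 t = ⊤` for `t > 0` and the recurrence (where
`p j` denotes the `(j+1)`-st job), then `F n t` is the infimum in `WithTop ℕ`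
of the machine-2 load over all assignments whose machine-1 load equals `t`. -/
theorem P2any_dp_correct (n : ℕ) (p : Fin n → ℕ × ℕ) (F : ℕ → ℕ → ℕ∞)
    (hF00 : F 0 0 = 0)
    (hF0 : ∀ t : ℕ, 0 < t → F 0 t = ⊤)
    (hFrec : ∀ (j : Fin n) (t : ℕ),
      F (j.val + 1) t =
        min (min (if (p j).1 ≤ t then F j.val (t - (p j).1) else ⊤)
                 (F j.val t + ((p j).1 : ℕ∞)))
            (if (p j).2 ≤ t then F j.val (t - (p j).2) + ((p j).2 : ℕ∞) else ⊤)) :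
    ∀ t : ℕ,
      F n t =
        sInf {x : ℕ∞ | ∃ g : Fin n → Fin 3, load1 p g = t ∧ x = (load2 p g : ℕ∞)} := by
  intro t
  refine le_antisymm (le_sInf ?_) ?_
  · rintro x ⟨g, rfl, rfl⟩
    exact dp_le_load2 n p F hF00 hFrec g
  · rcases dp_eq_top_or_exists_load2 n p F hF00 hF0 hFrec t with h | ⟨g, h1, h2⟩
    · exact h ▸ le_top
    · exact sInf_le ⟨g, h1, h2⟩
end

section
/- Let n ∈ ℕ and p : Fin n → Fin 3 → ℕ, where p j k is the processing time of job j when run on k+1 machines. An assignment is a map g : Fin n → {M : Finset (Fin 3) // M.Nonempty}; job j contributes p j (|g j| − 1) to the load of each machine in g j, and load_m(g) denotes the resulting load of machine m. Define F : ℕ → ℕ → ℕ → WithTop ℕ by F 0 0 0 = 0, F 0 t₁ t₂ = ⊤ for (t₁, t₂) ≠ (0, 0), and for 1 ≤ j ≤ n with q₁ := p (j−1) 0, q₂ := p (j−1) 1, q₃ := p (j−1) 2 the processing times of the j-th job, F j t₁ t₂ = min of the seven terms: F (j−1) (t₁ − q₁) t₂ if q₁ ≤ t₁; F (j−1) t₁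 (t₂ − q₁) if q₁ ≤ t₂; F (j−1) t₁ t₂ + q₁; F (j−1) (t₁ − q₂) (t₂ − q₂) if q₂ ≤ t₁ and q₂ ≤ t₂; F (j−1) (t₁ − q₂) t₂ + q₂ if q₂ ≤ t₁; F (j−1) t₁ (t₂ − q₂) + q₂ if q₂ ≤ t₂; and F (j−1) (t₁ − q₃) (t₂ − q₃) + q₃ if q₃ ≤ t₁ and q₃ ≤ t₂ (each term being ⊤ when its side condition fails). Then for all t₁, t₂ ∈ ℕ, F n t₁ t₂ equals the infimum in WithTop ℕ of load₃(g) over all assignments g with load₁(g) = t₁ and load₂(g) = t₂. -/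
/-- Load of machine `m` under an assignment `g` of each job to a nonempty set of
the three machines: job `j` contributes `p j (|g j| - 1)` (its processing time
when run on `|g j|` machines) to the load of each machine in `g j`. -/
def loadOf {n : ℕ} (p : Fin n → Fin 3 → ℕ)
    (g : Fin n → {M : Finset (Fin 3) // M.Nonempty}) (m : Fin 3) : ℕ :=
  ∑ j ∈ Finset.univ.filter (fun j => m ∈ (g j).1),
    p j ⟨(g j).1.card - 1, by
      have h := Finset.card_le_univ (g j).1
      simp only [Finset.card_univ, Fintype.card_fin] at h
      omega⟩

/-- The amount that a job with processing times `q` adds to the load of machine `m`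
when it is run on the set of machines `M`. -/
def contribution (q : Fin 3 → ℕ) (M : {M : Finset (Fin 3) // M.Nonempty}) (m : Fin 3) : ℕ :=
  if m ∈ M.1 then
    q ⟨M.1.card - 1, by
      have h := Finset.card_le_univ M.1
      rw [Fintype.card_fin] at h
      omega⟩
  else 0

theorem loadOf_eq_sum_contribution {n : ℕ} (p : Fin n → Fin 3 → ℕ)
    (g : Fin n → {M : Finset (Fin 3) // M.Nonempty}) (m : Fin 3) :
    loadOf p g m = ∑ j, contribution (p j) (g j) m := by
  simp only [loadOf, contribution, Finset.sum_filter]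

theorem loadOf_succ {n : ℕ} (p : Fin (n + 1) → Fin 3 → ℕ)
    (g : Fin (n + 1) → {M : Finset (Fin 3) // M.Nonempty}) (m : Fin 3) :
    loadOf p g m = loadOf (fun j => p j.castSucc) (fun j => g j.castSucc) m +
      contribution (p (Fin.last n)) (g (Fin.last n)) m := by
  simp only [loadOf_eq_sum_contribution, Fin.sum_univ_castSucc]

theorem nonempty_finset_fin_three_cases (M : {M : Finset (Fin 3) // M.Nonempty}) :
    M = ⟨{0}, by decide⟩ ∨ M = ⟨{1}, by decide⟩ ∨ M = ⟨{2}, by decide⟩ ∨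
      M = ⟨{0, 1}, by decide⟩ ∨ M = ⟨{0, 2}, by decide⟩ ∨ M = ⟨{1, 2}, by decide⟩ ∨
      M = ⟨{0, 1, 2}, by decide⟩ := by
  obtain ⟨M, hM⟩ := M
  simp only [Subtype.mk.injEq]
  revert M
  decide

/-- One step of the dynamic programming recurrence: the value at `(t₁, t₂)` obtained from the
table `f` of the preceding jobs by adding a job with processing times `q`. -/
noncomputable def dpStep (q : Fin 3 → ℕ) (f : ℕ → ℕ → ℕ∞) (t₁ t₂ : ℕ) : ℕ∞ :=
  min
    (min
      (min (if q 0 ≤ t₁ then f (t₁ - q 0) t₂ else ⊤)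
           (if q 0 ≤ t₂ then f t₁ (t₂ - q 0) else ⊤))
      (min (f t₁ t₂ + (q 0 : ℕ∞))
           (if q 1 ≤ t₁ ∧ q 1 ≤ t₂ then f (t₁ - q 1) (t₂ - q 1) else ⊤)))
    (min
      (min (if q 1 ≤ t₁ then f (t₁ - q 1) t₂ + (q 1 : ℕ∞) else ⊤)
           (if q 1 ≤ t₂ then f t₁ (t₂ - q 1) + (q 1 : ℕ∞) else ⊤))
      (if q 2 ≤ t₁ ∧ q 2 ≤ t₂ then f (t₁ - q 2) (t₂ - q 2) + (q 2 : ℕ∞) else ⊤))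

theorem dpStep_le (q : Fin 3 → ℕ) (f : ℕ → ℕ → ℕ∞) (s₁ s₂ : ℕ)
    (M : {M : Finset (Fin 3) // M.Nonempty}) :
    dpStep q f (s₁ + contribution q M 0) (s₂ + contribution q M 1) ≤
      f s₁ s₂ + (contribution q M 2 : ℕ∞) := by
  rcases nonempty_finset_fin_three_cases M with rfl | rfl | rfl | rfl | rfl | rfl | rfl <;>
    simp [dpStep, contribution]

theorem dpStep_eq_top_or_exists (q : Fin 3 → ℕ) (f : ℕ → ℕ → ℕ∞) (t₁ t₂ : ℕ) :
    dpStep q f t₁ t₂ = ⊤ ∨ ∃ (M : {M : Finset (Fin 3) // M.Nonempty}) (s₁ s₂ : ℕ),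
      s₁ + contribution q M 0 = t₁ ∧ s₂ + contribution q M 1 = t₂ ∧
        dpStep q f t₁ t₂ = f s₁ s₂ + (contribution q M 2 : ℕ∞) := by
  let P : ℕ∞ → Prop := fun x => x = ⊤ ∨ ∃ (M : {M : Finset (Fin 3) // M.Nonempty}) (s₁ s₂ : ℕ),
    s₁ + contribution q M 0 = t₁ ∧ s₂ + contribution q M 1 = t₂ ∧
      x = f s₁ s₂ + (contribution q M 2 : ℕ∞)
  have P_min {x y : ℕ∞} (hx : P x) (hy : P y) : P (min x y) := by
    rcases min_choice x y with h | h <;> rwa [h]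
  have P_ite {c : Prop} [Decidable c] {x : ℕ∞} (hx : c → P x) : P (if c then x else ⊤) := by
    split_ifs with h
    · exact hx h
    · exact Or.inl rfl
  refine P_min
    (P_min (P_min (P_ite fun h => Or.inr ⟨⟨{0}, by decide⟩, t₁ - q 0, t₂, ?_⟩)
        (P_ite fun h => Or.inr ⟨⟨{1}, by decide⟩, t₁, t₂ - q 0, ?_⟩))
      (P_min (Or.inr ⟨⟨{2}, by decide⟩, t₁, t₂, ?_⟩)
        (P_ite fun h => Or.inr ⟨⟨{0, 1}, by decide⟩, t₁ - q 1, t₂ - q 1, ?_⟩)))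
    (P_min (P_min (P_ite fun h => Or.inr ⟨⟨{0, 2}, by decide⟩, t₁ - q 1, t₂, ?_⟩)
        (P_ite fun h => Or.inr ⟨⟨{1, 2}, by decide⟩, t₁, t₂ - q 1, ?_⟩))
      (P_ite fun h => Or.inr ⟨⟨{0, 1, 2}, by decide⟩, t₁ - q 2, t₂ - q 2, ?_⟩)) <;>
    simp [contribution] <;> omega

theorem dp_le_loadOf {n : ℕ} (p : Fin n → Fin 3 → ℕ) (F : ℕ → ℕ → ℕ → ℕ∞)
    (hF000 : F 0 0 0 = 0)
    (hFrec : ∀ (j : Fin n) (t₁ t₂ : ℕ), F (j.val + 1) t₁ t₂ = dpStep (p j) (F j.val) t₁ t₂)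
    (g : Fin n → {M : Finset (Fin 3) // M.Nonempty}) :
    F n (loadOf p g 0) (loadOf p g 1) ≤ loadOf p g 2 := by
  induction n with
  | zero => simp [loadOf, hF000]
  | succ n ih =>
    have hrec := hFrec (Fin.last n)
    rw [Fin.val_last] at hrec
    rw [hrec, loadOf_succ p g 0, loadOf_succ p g 1, loadOf_succ p g 2, Nat.cast_add]
    refine (dpStep_le _ _ _ _ _).trans ?_
    gcongr
    exact ih (fun j => p j.castSucc) (fun j => hFrec j.castSucc) _

theorem dp_eq_top_or_exists_loadOf {n : ℕ} (p : Fin n → Fin 3 → ℕ) (F : ℕ → ℕ → ℕ → ℕ∞)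
    (hF000 : F 0 0 0 = 0)
    (hF0 : ∀ t₁ t₂ : ℕ, ¬(t₁ = 0 ∧ t₂ = 0) → F 0 t₁ t₂ = ⊤)
    (hFrec : ∀ (j : Fin n) (t₁ t₂ : ℕ), F (j.val + 1) t₁ t₂ = dpStep (p j) (F j.val) t₁ t₂)
    (t₁ t₂ : ℕ) :
    F n t₁ t₂ = ⊤ ∨ ∃ g : Fin n → {M : Finset (Fin 3) // M.Nonempty},
      loadOf p g 0 = t₁ ∧ loadOf p g 1 = t₂ ∧ F n t₁ t₂ = (loadOf p g 2 : ℕ∞) := by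
  induction n generalizing t₁ t₂ with
  | zero =>
    by_cases h : t₁ = 0 ∧ t₂ = 0
    · obtain ⟨rfl, rfl⟩ := h
      exact Or.inr ⟨Fin.elim0, by simp [loadOf, hF000]⟩
    · exact Or.inl (hF0 t₁ t₂ h)
  | succ n ih =>
    have hrec := hFrec (Fin.last n) t₁ t₂
    rw [Fin.val_last] at hrec
    rw [hrec]
    obtain h | ⟨M, s₁, s₂, rfl, rfl, h⟩ := dpStep_eq_top_or_exists (p (Fin.last n)) (F n) t₁ t₂
    · exact Or.inl h
    · rw [h]
      obtain h' | ⟨g, rfl, rfl, h'⟩ :=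
        ih (fun j => p j.castSucc) (fun j => hFrec j.castSucc) s₁ s₂
      · exact Or.inl (by rw [h', top_add])
      · refine Or.inr ⟨Fin.snoc (α := fun _ => {M : Finset (Fin 3) // M.Nonempty}) g M, ?_⟩
        simp [loadOf_succ, h']

/-- Correctness of the dynamic programming recurrence for `P3|any|C_max`:
if `F` satisfies `F 0 0 0 = 0`, `F 0 t₁ t₂ = ⊤` for `(t₁,t₂) ≠ (0,0)` and the
seven-way recurrence (where `p j` gives the processing times of the `(j+1)`-st
job on 1, 2 and 3 machines), then `F n t₁ t₂` is the infimum in `WithTop ℕ` of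
the machine-3 load over all assignments with machine-1 load `t₁` and
machine-2 load `t₂`. -/
theorem P3any_dp_correct (n : ℕ) (p : Fin n → Fin 3 → ℕ) (F : ℕ → ℕ → ℕ → ℕ∞)
    (hF000 : F 0 0 0 = 0)
    (hF0 : ∀ t₁ t₂ : ℕ, ¬(t₁ = 0 ∧ t₂ = 0) → F 0 t₁ t₂ = ⊤)
    (hFrec : ∀ (j : Fin n) (t₁ t₂ : ℕ),
      F (j.val + 1) t₁ t₂ =
        min
          (min
            (min (if p j 0 ≤ t₁ then F j.val (t₁ - p j 0) t₂ else ⊤)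
                 (if p j 0 ≤ t₂ then F j.val t₁ (t₂ - p j 0) else ⊤))
            (min (F j.val t₁ t₂ + (p j 0 : ℕ∞))
                 (if p j 1 ≤ t₁ ∧ p j 1 ≤ t₂ then
                    F j.val (t₁ - p j 1) (t₂ - p j 1) else ⊤)))
          (min
            (min (if p j 1 ≤ t₁ then F j.val (t₁ - p j 1) t₂ + (p j 1 : ℕ∞) else ⊤)
                 (if p j 1 ≤ t₂ then F j.val t₁ (t₂ - p j 1) + (p j 1 : ℕ∞) else ⊤))
            (if p j 2 ≤ t₁ ∧ p j 2 ≤ t₂ then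
               F j.val (t₁ - p j 2) (t₂ - p j 2) + (p j 2 : ℕ∞) else ⊤))) :
    ∀ t₁ t₂ : ℕ,
      F n t₁ t₂ =
        sInf {x : ℕ∞ | ∃ g : Fin n → {M : Finset (Fin 3) // M.Nonempty},
          loadOf p g 0 = t₁ ∧ loadOf p g 1 = t₂ ∧ x = (loadOf p g 2 : ℕ∞)} := by
  intro t₁ t₂
  apply le_antisymm
  · refine le_sInf ?_
    rintro x ⟨g, rfl, rfl, rfl⟩
    exact dp_le_loadOf p F hF000 hFrec g
  · obtain h | ⟨g, h₁, h₂, h⟩ := dp_eq_top_or_exists_loadOf p F hF000 hF0 hFrec t₁ t₂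
    · exact h ▸ le_top
    · exact sInf_le ⟨g, h₁, h₂, h⟩
end

section
/- Let n ∈ ℕ, a : Fin n → ℕ with a i ≥ 1 for all i, and T ∈ ℕ with T ≤ A, where A := ∑_i a i. Consider n + 1 jobs: for j ∈ Fin n, job j has processing time a j, weight a j and due date 0; the extra job N has processing time 1, weight 2 and due date T + 1. Let y := ∑_{(i,j) : i ≤ j} a i · a j + A − T (pair sum over ordered pairs (i, j) ∈ Fin n × Fin n with i ≤ j). Then there exists S ⊆ Fin n with ∑_{i ∈ S} a i = T if and only if there exists a single-machine schedule s for these n + 1 jobs whose total weighted tardiness ∑_j w j · max(C j − d j, 0) is at most y. -/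
/-- The sum of the products over the pairs ordered by an injective key does not depend on the
key. -/
lemma two_mul_sum_mul_sum_filter_le {ι α : Type*} [Fintype ι] [DecidableEq ι] [LinearOrder α]
    (a : ι → ℕ) {f : ι → α} (hf : Function.Injective f) :
    2 * ∑ j, a j * ∑ i with f i ≤ f j, a i = (∑ i, a i) ^ 2 + ∑ i, a i ^ 2 := by
  have key : ∑ j, a j * ∑ i with f i ≤ f j, a i =
      ∑ j, ∑ i, if f i ≤ f j then a j * a i else 0 := by
    refine Finset.sum_congr rfl fun j _ => ?_
    rw [Finset.mul_sum, Finset.sum_filter]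
  rw [two_mul]
  nth_rewrite 2 [key]
  rw [Finset.sum_comm, key, ← Finset.sum_add_distrib]
  simp_rw [← Finset.sum_add_distrib]
  have diag : ∑ i, a i ^ 2 = ∑ j, ∑ i, if j = i then a j * a i else 0 := by
    simp [sq]
  rw [sq, Finset.sum_mul_sum, diag, ← Finset.sum_add_distrib]
  simp_rw [← Finset.sum_add_distrib]
  refine Finset.sum_congr rfl fun j _ => Finset.sum_congr rfl fun i _ => ?_
  rcases lt_trichotomy (f i) (f j) with h | h | h
  · have hne : j ≠ i := fun e => h.ne (e ▸ rfl)
    simp [h.le, h.not_ge, hne]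
  · simp [hf h]
  · have hne : j ≠ i := fun e => h.ne (e ▸ rfl)
    simp [h.le, h.not_ge, hne, mul_comm]

lemma sum_mul_sum_filter_le_eq {n : ℕ} {α : Type*} [LinearOrder α] (a : Fin n → ℕ)
    {f : Fin n → α} (hf : Function.Injective f) :
    ∑ j, a j * ∑ i with f i ≤ f j, a i =
      ∑ q ∈ Finset.univ.filter (fun q : Fin n × Fin n => q.1 ≤ q.2), a q.1 * a q.2 := by
  have hid : ∑ q ∈ Finset.univ.filter (fun q : Fin n × Fin n => q.1 ≤ q.2), a q.1 * a q.2 =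
      ∑ j, a j * ∑ i with id i ≤ id j, a i := by
    rw [Finset.sum_filter, Fintype.sum_prod_type_right]
    refine Finset.sum_congr rfl fun j _ => ?_
    rw [Finset.mul_sum, Finset.sum_filter]
    simp [mul_comm]
  have h₁ := two_mul_sum_mul_sum_filter_le a hf
  have h₂ := two_mul_sum_mul_sum_filter_le a (f := (id : Fin n → Fin n)) Function.injective_id
  rw [hid]
  omega

lemma IsSchedule.sum_le_s15 {N : ℕ} {p s : Fin N → ℕ} (h : IsSchedule p s) (F : Finset (Fin N))
    {c : ℕ} (hc : ∀ i ∈ F, s i + p i ≤ c) : ∑ i ∈ F, p i ≤ c := by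
  have hdisj : (F : Set (Fin N)).PairwiseDisjoint fun i => Finset.Ico (s i) (s i + p i) := by
    intro i _ j _ hij
    refine Finset.disjoint_left.2 fun x hx hx' => ?_
    simp only [Finset.mem_Ico] at hx hx'
    have := h i j hij
    omega
  have hsub : F.biUnion (fun i => Finset.Ico (s i) (s i + p i)) ⊆ Finset.range c := by
    intro x hx
    simp only [Finset.mem_biUnion, Finset.mem_Ico, Finset.mem_range] at hx ⊢
    obtain ⟨i, hi, hx⟩ := hx
    have := hc i hi
    omega
  simpa [Finset.card_biUnion hdisj] using Finset.card_le_card hsub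

/-- With an additional job, the schedule condition splits into the condition on the original
jobs and the comparison of each of them with the additional one. -/
lemma isSchedule_snoc {n : ℕ} {p s : Fin n → ℕ} {q t : ℕ} :
    IsSchedule (Fin.snoc p q : Fin (n + 1) → ℕ) (Fin.snoc s t) ↔
      IsSchedule p s ∧ ∀ i, s i + p i ≤ t ∨ t + q ≤ s i := by
  constructor
  · intro h
    refine ⟨fun i j hij => ?_, fun i => ?_⟩
    · simpa using h i.castSucc j.castSucc (by simpa using hij)
    · simpa using h i.castSucc (Fin.last n) (Fin.castSucc_lt_last i).ne
  · rintro ⟨h, hb⟩ i j hij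
    induction i using Fin.lastCases with
    | last =>
      induction j using Fin.lastCases with
      | last => exact absurd rfl hij
      | cast j => simpa using (hb j).symm
    | cast i =>
      induction j using Fin.lastCases with
      | last => simpa using hb i
      | cast j => simpa using h i j (by simpa using hij)

/-- The jobs that start no later than `j` all fit before the completion of `j`, together with the
unit barrier job if that one precedes `j`. -/
lemma sum_filter_add_ite_le_completion {n : ℕ} {a s : Fin n → ℕ} {t : ℕ} (ha : ∀ i, 1 ≤ a i)
    (h : IsSchedule (Fin.snoc a 1 : Fin (n + 1) → ℕ) (Fin.snoc s t)) (j : Fin n) :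
    (∑ i with s i ≤ s j, a i) + (if s j < t then 0 else 1) ≤ s j + a j := by
  obtain ⟨hs, hb⟩ := isSchedule_snoc.1 h
  have hle : ∀ i, s i ≤ s j → s i + a i ≤ s j + a j := by
    intro i hi
    rcases eq_or_ne i j with rfl | hij
    · rfl
    · have := hs i j hij
      have := ha j
      omega
  split_ifs with hj
  · rw [add_zero]
    exact hs.sum_le_s15 _ fun i hi => hle i (Finset.mem_filter.1 hi).2
  · have := h.sum_le_s15 (Finset.cons (Fin.last n)
      ((Finset.univ.filter fun i => s i ≤ s j).map Fin.castSuccEmb)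
      (by simp [(Fin.castSucc_lt_last _).ne])) (c := s j + a j) (by
        intro i hi
        induction i using Fin.lastCases with
        | last =>
          have := hb j
          have := ha j
          simp only [Fin.snoc_last]
          omega
        | cast i =>
          have hi' : s i ≤ s j := by
            simpa [(Fin.castSucc_lt_last _).ne] using hi
          simpa using hle i hi')
    rw [Finset.sum_cons, Finset.sum_map] at this
    simp only [Fin.snoc_last, Fin.coe_castSuccEmb, Fin.snoc_castSucc] at this
    omega

/-- Total weighted tardiness of the reduced instance, with the barrier job separated. -/
lemma sum_snoc_weighted_tardiness {n : ℕ} (a s : Fin n → ℕ) (t T : ℕ) :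
    ∑ j, (Fin.snoc a 2 : Fin (n + 1) → ℕ) j *
        (((Fin.snoc s t : Fin (n + 1) → ℕ) j + (Fin.snoc a 1 : Fin (n + 1) → ℕ) j) -
          (Fin.snoc (fun _ => 0) (T + 1) : Fin (n + 1) → ℕ) j) =
      (∑ j, a j * (s j + a j)) + 2 * (t - T) := by
  simp [Fin.sum_univ_castSucc]

lemma exists_sum_eq_of_schedule {n : ℕ} {a s : Fin n → ℕ} {t T : ℕ} (ha : ∀ i, 1 ≤ a i)
    (hT : T ≤ ∑ i, a i) (h : IsSchedule (Fin.snoc a 1 : Fin (n + 1) → ℕ) (Fin.snoc s t))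
    (hcost : (∑ j, a j * (s j + a j)) + 2 * (t - T) ≤
      (∑ q ∈ Finset.univ.filter (fun q : Fin n × Fin n => q.1 ≤ q.2), a q.1 * a q.2) +
        ((∑ i, a i) - T)) :
    ∃ S : Finset (Fin n), ∑ i ∈ S, a i = T := by
  obtain ⟨hs, hb⟩ := isSchedule_snoc.1 h
  have hinj : Function.Injective s := by
    intro i j hij
    by_contra hne
    have := hs i j hne
    have := ha i
    have := ha j
    omega
  have hbefore : ∑ i with s i < t, a i ≤ t := hs.sum_le_s15 _ fun i hi => by
    have := hb i
    simp only [Finset.mem_filter] at hi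
    omega
  have hlower := Finset.sum_le_sum fun j (_ : j ∈ Finset.univ) =>
    Nat.mul_le_mul_left (a j) (sum_filter_add_ite_le_completion ha h j)
  simp only [mul_add, mul_ite, mul_zero, mul_one, Finset.sum_add_distrib] at hlower hcost
  rw [sum_mul_sum_filter_le_eq a hinj] at hlower
  have hsplit : ∑ i, a i = ∑ i with s i < t, a i + ∑ j, (if s j < t then 0 else a j) := by
    rw [Finset.sum_filter, ← Finset.sum_add_distrib]
    exact Finset.sum_congr rfl fun i _ => by split_ifs <;> simp
  exact ⟨Finset.univ.filter fun i => s i < t, by omega⟩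

lemma exists_schedule_of_sum_eq {n : ℕ} (a : Fin n → ℕ) (S : Finset (Fin n)) :
    ∃ s : Fin n → ℕ,
      IsSchedule (Fin.snoc a 1 : Fin (n + 1) → ℕ) (Fin.snoc s (∑ i ∈ S, a i)) ∧
      ∑ j, a j * (s j + a j) =
        (∑ q ∈ Finset.univ.filter (fun q : Fin n × Fin n => q.1 ≤ q.2), a q.1 * a q.2) +
          ((∑ i, a i) - ∑ i ∈ S, a i) := by
  let f : Fin n → ℕ := fun i => if i ∈ S then i else n + i
  have hf : Function.Injective f := by
    intro i j hij
    simp only [f] at hij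
    ext
    split_ifs at hij <;> omega
  let b : Fin n → ℕ := fun j => if j ∈ S then 0 else 1
  have hb : ∀ i j, f i < f j → b i ≤ b j := by
    intro i j hij
    simp only [f, b] at hij ⊢
    split_ifs at hij ⊢ <;> omega
  have hC : ∀ j, (∑ i with f i < f j, a i) + b j + a j = (∑ i with f i ≤ f j, a i) + b j := by
    intro j
    have : Finset.univ.filter (fun i => f i ≤ f j) =
        Finset.cons j (Finset.univ.filter fun i => f i < f j) (by simp) := by
      ext i
      simp [le_iff_lt_or_eq, hf.eq_iff, or_comm]
    rw [this, Finset.sum_cons]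
    ring
  have hlt : ∀ i j, f i < f j →
      (∑ k with f k < f i, a k) + b i + a i ≤ (∑ k with f k < f j, a k) + b j := by
    intro i j hij
    rw [hC]
    refine add_le_add (Finset.sum_le_sum_of_subset fun k hk => ?_) (hb i j hij)
    simp only [Finset.mem_filter, Finset.mem_univ, true_and] at hk ⊢
    omega
  refine ⟨fun j => (∑ i with f i < f j, a i) + b j, isSchedule_snoc.2 ⟨?_, ?_⟩, ?_⟩
  · intro i j hij
    exact (lt_or_gt_of_ne (hf.ne hij)).imp (hlt i j) (hlt j i)
  · intro i
    by_cases hi : i ∈ S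
    · left
      rw [hC, show b i = 0 by simp [b, hi], add_zero]
      refine Finset.sum_le_sum_of_subset fun k hk => ?_
      by_contra hkS
      simp only [f, hi, hkS, if_true, if_false, Finset.mem_filter] at hk
      omega
    · right
      simp only [show b i = 1 by simp [b, hi]]
      refine Nat.add_le_add_right (Finset.sum_le_sum_of_subset fun k hk => ?_) 1
      simp only [f, hi, hk, if_true, if_false, Finset.mem_filter, Finset.mem_univ, true_and]
      omega
  · simp only [hC]
    simp only [mul_add, Finset.sum_add_distrib]
    rw [sum_mul_sum_filter_le_eq a hf]
    congr 1
    refine Nat.eq_sub_of_add_eq ?_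
    rw [← Fintype.sum_ite_mem S a, ← Finset.sum_add_distrib]
    exact Finset.sum_congr rfl fun i _ => by simp only [b]; split_ifs <;> simp

/-- Correctness of the Lenstra–Rinnooy Kan–Brucker reduction from Subset Sum to
`1||∑wⱼTⱼ`: the `n` original jobs have `p_j = w_j = a j` and due date `0`, the
extra job has processing time `1`, weight `2` and due date `T + 1`, and the
threshold is `y = ∑_{(i,j) : i ≤ j} a i · a j + (A − T)`. Some subset of the
items sums to `T` iff there is a single-machine schedule of the `n + 1` jobs
with total weighted tardiness (tardiness `C_j − d_j` truncated at `0`) at most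
`y`. -/
theorem subsetSum_to_weightedTardiness (n : ℕ) (a : Fin n → ℕ)
    (ha : ∀ i, 1 ≤ a i) (T : ℕ) (hT : T ≤ ∑ i, a i) :
    (∃ S : Finset (Fin n), ∑ i ∈ S, a i = T) ↔
      (∃ s : Fin (n + 1) → ℕ, IsSchedule (Fin.snoc a 1) s ∧
        ∑ j, (Fin.snoc a 2 : Fin (n + 1) → ℕ) j *
            ((s j + (Fin.snoc a 1 : Fin (n + 1) → ℕ) j) -
              (Fin.snoc (fun _ => 0) (T + 1) : Fin (n + 1) → ℕ) j) ≤
          (∑ q ∈ Finset.univ.filter (fun q : Fin n × Fin n => q.1 ≤ q.2),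
              a q.1 * a q.2) +
            ((∑ i, a i) - T)) := by
  constructor
  · rintro ⟨S, rfl⟩
    obtain ⟨s, hs, hcost⟩ := exists_schedule_of_sum_eq a S
    refine ⟨_, hs, ?_⟩
    rw [sum_snoc_weighted_tardiness, hcost]
    simp
  · rintro ⟨s, hs, hcost⟩
    obtain ⟨s, t, rfl⟩ : ∃ (s' : Fin n → ℕ) (t : ℕ), s = Fin.snoc s' t :=
      ⟨Fin.init s, s (Fin.last n), (Fin.snoc_init_self s).symm⟩
    rw [sum_snoc_weighted_tardiness] at hcost
    exact exists_sum_eq_of_schedule ha hT hs hcost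
end

section
/- Let n ∈ ℕ, a : Fin n → ℕ with a i ≥ 1 for all i, and T ∈ ℕ with T ≤ A, where A := ∑_i a i. Consider n + 1 jobs: for j ∈ Fin n, job j has processing time a j, weight a j and deadline A + 1; the extra job N has processing time 1, weight 0 and deadline T + 1. Let y := ∑_{(i,j) : i ≤ j} a i · a j + A − T (pair sum over ordered pairs (i, j) ∈ Fin n × Fin n with i ≤ j). Then there exists S ⊆ Fin n with ∑_{i ∈ S} a i = T if and only if there exists a single-machine schedule s for these n + 1 jobs with s j + p j ≤ d̄ j for every job j (every job meets its deadline) and total weighted completion time ∑_j w j · (s j + p j) ≤ y. -/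
open Finset in
/-- Disjoint execution intervals that all end by time `M` have total length at most `M`. -/
theorem IsSchedule.sum_le_of_forall_completion_le_s18 {N : ℕ} {p s : Fin N → ℕ}
    (h : IsSchedule p s) {F : Finset (Fin N)} {M : ℕ} (hF : ∀ i ∈ F, s i + p i ≤ M) :
    ∑ i ∈ F, p i ≤ M := by
  have hdisj : (F : Set (Fin N)).PairwiseDisjoint fun i => Ico (s i) (s i + p i) := by
    intro i _ j _ hij
    refine Finset.disjoint_left.2 fun x hi hj => ?_
    rw [mem_Ico] at hi hj
    have := h i j hij
    omega
  have hsub : F.biUnion (fun i => Ico (s i) (s i + p i)) ⊆ range M := by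
    intro x hx
    obtain ⟨i, hi, hx⟩ := mem_biUnion.1 hx
    have := hF i hi
    rw [mem_Ico] at hx
    rw [mem_range]
    omega
  simpa [card_biUnion hdisj] using card_le_card hsub

open Finset in
/-- The weighted sum of prefix sums, with equal weights and lengths, does not depend on the order
in which the items are taken. -/
theorem two_mul_sum_mul_prefix_sum {ι : Type*} [Fintype ι] (a f : ι → ℕ)
    (hf : Function.Injective f) :
    2 * ∑ j, a j * ∑ i with f i ≤ f j, a i = (∑ i, a i) ^ 2 + ∑ i, a i ^ 2 := by
  classical
  have hexp : ∑ j, a j * ∑ i with f i ≤ f j, a i =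
      ∑ j, ∑ i, if f i ≤ f j then a j * a i else 0 := by
    simp only [sum_filter, mul_sum, mul_ite, mul_zero]
  have hdiag : ∑ i, a i ^ 2 = ∑ j, ∑ i, if i = j then a j * a i else 0 := by
    simp [sq]
  have hswap : ∑ j, a j * ∑ i with f i ≤ f j, a i =
      ∑ j, ∑ i, if f j ≤ f i then a i * a j else 0 := by
    rw [hexp, sum_comm]
  rw [two_mul]
  nth_rewrite 1 [hexp]
  rw [hswap, sq, sum_mul_sum, hdiag]
  simp only [← sum_add_distrib]
  refine sum_congr rfl fun j _ => sum_congr rfl fun i _ => ?_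
  have hij : f i = f j ↔ i = j := hf.eq_iff
  by_cases h : i = j
  · simp [h]
  · have hne : f i ≠ f j := mt hij.1 h
    rcases lt_or_gt_of_ne hne with hlt | hlt
    · simp [h, hlt.le, hlt.not_ge]
    · simp [h, hlt.le, hlt.not_ge, mul_comm]

open Finset in
theorem sum_mul_prefix_sum_eq_sum_pairs {n : ℕ} (a f : Fin n → ℕ) (hf : Function.Injective f) :
    ∑ j, a j * ∑ i with f i ≤ f j, a i =
      ∑ q ∈ univ.filter (fun q : Fin n × Fin n => q.1 ≤ q.2), a q.1 * a q.2 := by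
  have hpairs : ∑ q ∈ univ.filter (fun q : Fin n × Fin n => q.1 ≤ q.2), a q.1 * a q.2 =
      ∑ j, a j * ∑ i : Fin n with i.val ≤ j.val, a i := by
    simp only [sum_filter, Fintype.sum_prod_type_right, mul_sum, mul_ite, mul_zero,
      Fin.val_fin_le, mul_comm]
  have h₁ := two_mul_sum_mul_prefix_sum a f hf
  have h₂ := two_mul_sum_mul_prefix_sum a (fun i => (i : ℕ)) Fin.val_injective
  rw [hpairs]
  omega

open Finset in
/-- Run the jobs in increasing order of `f`, with those outside `S` delayed by one time unit. -/
def delayedStart {n : ℕ} (a f : Fin n → ℕ) (S : Finset (Fin n)) (j : Fin n) : ℕ :=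
  (∑ i with f i < f j, a i) + if j ∈ S then 0 else 1

open Finset in
theorem delayedStart_add {n : ℕ} (a : Fin n → ℕ) {f : Fin n → ℕ} (hf : Function.Injective f)
    (S : Finset (Fin n)) (j : Fin n) :
    delayedStart a f S j + a j = (∑ i with f i ≤ f j, a i) + if j ∈ S then 0 else 1 := by
  have h : univ.filter (fun i => f i ≤ f j) = insert j (univ.filter fun i => f i < f j) := by
    ext i
    simp [le_iff_eq_or_lt, hf.eq_iff]
  rw [h, sum_insert (by simp), delayedStart]
  ring

/-- A key that orders the elements of `S` before all others. -/
def firstKey {n : ℕ} (S : Finset (Fin n)) (i : Fin n) : ℕ :=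
  i + if i ∈ S then 0 else n

theorem firstKey_injective {n : ℕ} (S : Finset (Fin n)) : Function.Injective (firstKey S) := by
  intro i j h
  have := i.isLt
  have := j.isLt
  simp only [firstKey] at h
  ext
  split_ifs at h <;> omega

theorem firstKey_lt {n : ℕ} {S : Finset (Fin n)} {i j : Fin n} (hi : i ∈ S) (hj : j ∉ S) :
    firstKey S i < firstKey S j := by
  simp only [firstKey, hi, hj, if_true, if_false]
  omega

open Finset in
theorem delayedStart_disjoint {n : ℕ} (a : Fin n → ℕ) (S : Finset (Fin n)) {i j : Fin n}
    (h : firstKey S i < firstKey S j) :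
    delayedStart a (firstKey S) S i + a i ≤ delayedStart a (firstKey S) S j := by
  rw [delayedStart_add a (firstKey_injective S), delayedStart]
  refine Nat.add_le_add (sum_le_sum_of_subset fun k hk => ?_) ?_
  · simp only [mem_filter, mem_univ, true_and] at hk ⊢
    omega
  · by_cases hj : j ∈ S
    · have hi : i ∈ S := by
        by_contra hi
        exact (firstKey_lt hj hi).not_gt h
      simp [hi, hj]
    · split_ifs <;> simp

open Finset in
theorem sum_compl_eq_sub {n : ℕ} (a : Fin n → ℕ) (S : Finset (Fin n)) :
    ∑ j, a j * (if j ∈ S then 0 else 1) = (∑ i, a i) - ∑ i ∈ S, a i := by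
  rw [← sum_compl_add_sum S a, Nat.add_sub_cancel]
  rw [← sum_compl_add_sum S]
  have hS : ∑ j ∈ S, a j * (if j ∈ S then 0 else 1) = 0 :=
    sum_eq_zero fun j hj => by simp [hj]
  rw [hS, add_zero]
  exact sum_congr rfl fun j hj => by simp [mem_compl.1 hj]

/-- Correctness of the Lenstra–Rinnooy Kan–Brucker reduction from Subset Sum to
`1|C_j ≤ d̄_j|∑wⱼCⱼ`: the `n` original jobs have `p_j = w_j = a j` and deadline
`A + 1`, the extra job has processing time `1`, weight `0` and deadline `T + 1`,
and the threshold is `y = ∑_{(i,j) : i ≤ j} a i · a j + (A − T)`. Some subset of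
the items sums to `T` iff there is a single-machine schedule of the `n + 1`
jobs in which every job meets its deadline and the total weighted completion
time is at most `y`. -/
theorem subsetSum_to_deadlinesWeightedCompletion (n : ℕ) (a : Fin n → ℕ)
    (ha : ∀ i, 1 ≤ a i) (T : ℕ) (hT : T ≤ ∑ i, a i) :
    (∃ S : Finset (Fin n), ∑ i ∈ S, a i = T) ↔
      (∃ s : Fin (n + 1) → ℕ, IsSchedule (Fin.snoc a 1) s ∧
        (∀ j, s j + (Fin.snoc a 1 : Fin (n + 1) → ℕ) j ≤
          (Fin.snoc (fun _ => (∑ i, a i) + 1) (T + 1) : Fin (n + 1) → ℕ) j) ∧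
        ∑ j, (Fin.snoc a 0 : Fin (n + 1) → ℕ) j *
            (s j + (Fin.snoc a 1 : Fin (n + 1) → ℕ) j) ≤
          (∑ q ∈ Finset.univ.filter (fun q : Fin n × Fin n => q.1 ≤ q.2),
              a q.1 * a q.2) +
            ((∑ i, a i) - T)) := by
  constructor
  · rintro ⟨S, hS⟩
    have hinj := firstKey_injective S
    have hend : ∀ i ∈ S, delayedStart a (firstKey S) S i + a i ≤ T := by
      intro i hi
      rw [delayedStart_add a hinj, if_pos hi, add_zero, ← hS]
      refine Finset.sum_le_sum_of_subset fun k hk => ?_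
      by_contra hkS
      exact (firstKey_lt hi hkS).not_ge (Finset.mem_filter.1 hk).2
    have hstart : ∀ i ∉ S, T + 1 ≤ delayedStart a (firstKey S) S i := by
      intro i hi
      rw [delayedStart, if_neg hi, ← hS]
      refine Nat.add_le_add_right (Finset.sum_le_sum_of_subset fun k hk => ?_) 1
      simpa using firstKey_lt hk hi
    refine ⟨Fin.snoc (delayedStart a (firstKey S) S) T, ?_, ?_, ?_⟩
    · intro i j hij
      induction i using Fin.lastCases with
      | last =>
        induction j using Fin.lastCases with
        | last => exact absurd rfl hij
        | cast j =>
          simp only [Fin.snoc_last, Fin.snoc_castSucc]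
          by_cases hj : j ∈ S
          · exact Or.inr (hend j hj)
          · exact Or.inl (hstart j hj)
      | cast i =>
        induction j using Fin.lastCases with
        | last =>
          simp only [Fin.snoc_last, Fin.snoc_castSucc]
          by_cases hi : i ∈ S
          · exact Or.inl (hend i hi)
          · exact Or.inr (hstart i hi)
        | cast j =>
          simp only [Fin.snoc_castSucc]
          have hne : i ≠ j := fun h => hij (h ▸ rfl)
          rcases lt_or_gt_of_ne (hinj.ne hne) with h | h
          · exact Or.inl (delayedStart_disjoint a S h)
          · exact Or.inr (delayedStart_disjoint a S h)
    · intro j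
      induction j using Fin.lastCases with
      | last => simp
      | cast j =>
        simp only [Fin.snoc_castSucc]
        rw [delayedStart_add a hinj]
        refine Nat.add_le_add (Finset.sum_le_sum_of_subset (Finset.filter_subset _ _)) ?_
        split_ifs <;> simp
    · rw [Fin.sum_univ_castSucc]
      simp only [Fin.snoc_last, Fin.snoc_castSucc, zero_mul, add_zero]
      simp only [delayedStart_add a hinj, mul_add, Finset.sum_add_distrib]
      rw [sum_mul_prefix_sum_eq_sum_pairs a _ hinj, sum_compl_eq_sub, hS]
  · rintro ⟨s, hs, hdl, hcost⟩
    set x : Fin n → ℕ := fun i => s i.castSucc with hx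
    set b := s (Fin.last n) with hb
    have hbT : b ≤ T := by simpa using hdl (Fin.last n)
    have hdisj : ∀ i j, i ≠ j → x i + a i ≤ x j ∨ x j + a j ≤ x i := fun i j hij => by
      simpa using hs i.castSucc j.castSucc (by simpa using hij)
    have hbar : ∀ i, x i + a i ≤ b ∨ b + 1 ≤ x i := fun i => by
      simpa using hs i.castSucc (Fin.last n) (Fin.castSucc_lt_last i).ne
    have hinj : Function.Injective x := by
      intro i j hij
      by_contra hne
      have := hdisj i j hne
      have := ha i
      have := ha j
      omega
    set S : Finset (Fin n) := Finset.univ.filter fun i => x i + a i ≤ b with hSdef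
    have hmem : ∀ i, i ∈ S ↔ x i + a i ≤ b := by simp [hSdef]
    have hpack : ∑ i ∈ S, a i ≤ b := by
      have := hs.sum_le_of_forall_completion_le_s18 (F := S.map Fin.castSuccEmb) (M := b) (by
        intro i hi
        obtain ⟨k, hk, rfl⟩ := Finset.mem_map.1 hi
        simpa using (hmem k).1 hk)
      simpa using this
    have hcompl : ∀ j, (∑ i with x i ≤ x j, a i) + (if j ∈ S then 0 else 1) ≤ x j + a j := by
      intro j
      have := hs.sum_le_of_forall_completion_le_s18
        (F := Finset.univ.filter fun i => s i ≤ s j.castSucc) (M := x j + a j) (by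
          intro i hi
          have hi := (Finset.mem_filter.1 hi).2
          by_cases hij : i = j.castSucc
          · simp [hij, hx]
          · have := hs i j.castSucc hij
            have := ha j
            have hxj : x j = s j.castSucc := rfl
            simp only [Fin.snoc_castSucc] at *
            omega)
      rw [Finset.sum_filter, Fin.sum_univ_castSucc] at this
      simp only [Fin.snoc_castSucc, Fin.snoc_last, ← Finset.sum_filter] at this
      refine le_trans (Nat.add_le_add_left ?_ _) this
      by_cases hj : j ∈ S
      · simp [hj]
      · have hle : s (Fin.last n) ≤ s j.castSucc := by
          have := hbar j
          rw [hmem] at hj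
          simp only [hx, hb] at *
          omega
        simp [hle, hj]
    have hlow : (∑ j, a j * ∑ i with x i ≤ x j, a i) + ∑ j, a j * (if j ∈ S then 0 else 1) ≤
        ∑ j, a j * (x j + a j) := by
      rw [← Finset.sum_add_distrib]
      refine Finset.sum_le_sum fun j _ => ?_
      rw [← mul_add]
      exact Nat.mul_le_mul_left _ (hcompl j)
    rw [Fin.sum_univ_castSucc] at hcost
    simp only [Fin.snoc_last, Fin.snoc_castSucc, zero_mul, add_zero] at hcost
    rw [sum_mul_prefix_sum_eq_sum_pairs a x hinj, sum_compl_eq_sub] at hlow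
    have := hlow.trans hcost
    have hSA : ∑ i ∈ S, a i ≤ ∑ i, a i := Finset.sum_le_sum_of_subset (Finset.subset_univ S)
    exact ⟨S, by omega⟩
end

section
/- Let n ∈ ℕ and a : Fin n → ℕ with A := ∑_j a j even. An assignment is a map g : Fin n → Fin 3, where g j = 0 means job j runs on machine 1 (contributing a j to load₁), g j = 1 means job j runs on machine 2 (contributing a j to load₂), and g j = 2 means job j runs on both machines (contributing a j to both load₁ and load₂). Then there exists S ⊆ Fin n with 2 · ∑_{i ∈ S} a i = A if and only if there exists an assignment g with load₁(g) ≤ A/2 and load₂(g) ≤ A/2. -/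
/-- Splitting a sum over the fibres of a map to `Fin 3`. -/
theorem sum_filter_fin_three {ι M : Type*} [Fintype ι] [AddCommMonoid M]
    (g : ι → Fin 3) (f : ι → M) :
    (∑ j ∈ Finset.univ.filter (fun j => g j = 0), f j) +
        (∑ j ∈ Finset.univ.filter (fun j => g j = 1), f j) +
          (∑ j ∈ Finset.univ.filter (fun j => g j = 2), f j) = ∑ j, f j := by
  rw [← Finset.sum_fiberwise Finset.univ g f, Fin.sum_univ_three]

/-- Correctness of the reduction from Partition to the moldable scheduling
problem `P2|any|C_max` in which each job takes time `a j` whether run on one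
machine or on both: `g j = 0` puts job `j` on machine 1, `g j = 1` on machine
2, and `g j = 2` on both machines (contributing `a j` to both loads). A
partition into two halves of equal sum exists iff there is an assignment with
both machine loads at most `A/2`. -/
theorem partition_to_P2anyCmax (n : ℕ) (a : Fin n → ℕ)
    (hA : Even (∑ j, a j)) :
    (∃ S : Finset (Fin n), 2 * ∑ i ∈ S, a i = ∑ j, a j) ↔
      (∃ g : Fin n → Fin 3,
        (∑ j ∈ Finset.univ.filter (fun j => g j = 0), a j) +
            (∑ j ∈ Finset.univ.filter (fun j => g j = 2), a j) ≤
          (∑ j, a j) / 2 ∧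
        (∑ j ∈ Finset.univ.filter (fun j => g j = 1), a j) +
            (∑ j ∈ Finset.univ.filter (fun j => g j = 2), a j) ≤
          (∑ j, a j) / 2) := by
  constructor
  · rintro ⟨S, hS⟩
    let g : Fin n → Fin 3 := fun j => if j ∈ S then 0 else 1
    have h0 : Finset.univ.filter (fun j => g j = 0) = S := by
      ext j
      by_cases hj : j ∈ S <;> simp [g, hj]
    have h2 : Finset.univ.filter (fun j => g j = 2) = ∅ := by
      ext j
      by_cases hj : j ∈ S <;> simp [g, hj]
    have hsum := sum_filter_fin_three g a
    refine ⟨g, ?_⟩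
    rw [h0, h2, Finset.sum_empty] at *
    omega
  · rintro ⟨g, h1, h2⟩
    have hsum := sum_filter_fin_three g a
    obtain ⟨k, hk⟩ := hA
    exact ⟨Finset.univ.filter (fun j => g j = 0), by omega⟩
end
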